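/- Let H ⊆ ℓ²(ℕ, ℂ) and suppose h = (h_m) ∈ ℓ² satisfies ∑_{m=1}^∞ û(ω_m) h̄_m = 0 for every u ∈ C_c^∞((0,∞), ℝ), where û(ω) = ∫₀^∞ e^{iωs} u(s) ds, the ω_m are pairwise distinct reals with ω_1 = 0 and ∑_{m≥2} |ω_m|^{-p} < ∞ for some p ≥ 1. Then h = 0. -/

import Mathlib

open MeasureTheory

/-- The transform `û(ω) = ∫ e^{iωs} u(s) ds` over the whole line. -/
noncomputable def expTransform (u : ℝ → ℂ) (x : ℝ) : ℂ :=
  ∫ s : ℝ, Complex.exp (Complex.I * x * s) * u s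

lemma expTransform_eq_fourier (u : ℝ → ℂ) (x : ℝ) :
    expTransform u x = FourierTransform.fourier u (-x / (2 * Real.pi)) := by
  rw [expTransform, Real.fourier_real_eq_integral_exp_smul]
  congr 1 with s
  rw [smul_eq_mul]
  congr 2
  push_cast
  have : (Real.pi : ℂ) ≠ 0 := by exact_mod_cast Real.pi_ne_zero
  field_simp

/-- The transform of a test function decays faster than any power. -/
lemma exists_norm_expTransform_le {u : ℝ → ℂ} (hu : ContDiff ℝ (⊤ : ℕ∞) u)
    (hc : HasCompactSupport u) (p : ℕ) :
    ∃ C : ℝ, 0 < C ∧ ∀ x, |x| ^ p * ‖expTransform u x‖ ≤ C := by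
  obtain ⟨C, hC, h⟩ :=
    (FourierTransform.fourier (hc.toSchwartzMap hu) : SchwartzMap ℝ ℂ).decay p 0
  refine ⟨(2 * Real.pi) ^ p * C, by positivity, fun x => ?_⟩
  have h1 := h (-x / (2 * Real.pi))
  rw [norm_iteratedFDeriv_zero, SchwartzMap.fourier_coe] at h1
  have h2 : FourierTransform.fourier (⇑(hc.toSchwartzMap hu)) (-x / (2 * Real.pi))
      = expTransform u x := (expTransform_eq_fourier u x).symm
  rw [h2, Real.norm_eq_abs, abs_div, abs_neg, abs_of_pos Real.two_pi_pos, div_pow,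
    div_mul_eq_mul_div, div_le_iff₀ (by positivity)] at h1
  linarith

lemma integrable_exp_mul {u : ℝ → ℂ} (hu : Continuous u) (hc : HasCompactSupport u) (x : ℝ) :
    Integrable fun s : ℝ => Complex.exp (Complex.I * x * s) * u s :=
  Continuous.integrable_of_hasCompactSupport (by fun_prop) hc.mul_left

/-- Dilating and modulating `u` rescales and shifts its transform. -/
lemma expTransform_dilate_modulate (u : ℝ → ℂ) (a x : ℝ) {T : ℝ} (hT : 0 < T) :
    expTransform (fun s => Complex.exp (-(Complex.I * a * s)) * ((T⁻¹ : ℝ) * u (s / T))) x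
      = expTransform u (T * (x - a)) := by
  have key := Measure.integral_comp_div
    (fun s : ℝ => Complex.exp (Complex.I * (T * (x - a) : ℝ) * s) * u s) T
  have hT' : (T : ℂ) ≠ 0 := by exact_mod_cast hT.ne'
  calc _ = ∫ s : ℝ, ((T⁻¹ : ℝ) : ℂ) *
        (Complex.exp (Complex.I * (T * (x - a) : ℝ) * (s / T : ℝ)) * u (s / T)) := by
        unfold expTransform
        congr 1 with s
        rw [← mul_assoc, ← Complex.exp_add, mul_left_comm]
        congr 3
        push_cast
        field_simp
        ring
    _ = _ := by
        rw [integral_const_mul, key, abs_of_pos hT, Complex.real_smul, ← mul_assoc]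
        simp [hT', expTransform]

/-- Shifting a summable family of inverse powers by a constant keeps it summable. -/
lemma summable_one_div_abs_sub_pow {p : ℕ} {x : ℕ → ℝ} (hx : ∀ᶠ m in .atTop, x m ≠ 0)
    (hsum : Summable fun m => 1 / |x m| ^ p) (a : ℝ) :
    Summable fun m => 1 / |x m - a| ^ p := by
  have hsmall : ∀ᶠ m in .atTop, 1 / |x m| ^ p < 1 / (2 * |a| + 1) ^ p :=
    hsum.tendsto_atTop_zero.eventually_lt_const (by positivity)
  refine Summable.of_norm_bounded_eventually_nat (hsum.mul_left (2 ^ p)) ?_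
  filter_upwards [hx, hsmall] with m hm hlt
  have hpos : 0 < |x m| := abs_pos.mpr hm
  have hlarge : 2 * |a| + 1 < |x m| :=
    lt_of_pow_lt_pow_left₀ p hpos.le
      ((one_div_lt_one_div (by positivity) (by positivity)).mp hlt)
  have hsub : |x m| / 2 ≤ |x m - a| := by
    have := abs_sub_abs_le_abs_sub (x m) a
    linarith [abs_nonneg a]
  rw [Real.norm_of_nonneg (by positivity)]
  calc 1 / |x m - a| ^ p ≤ 1 / (|x m| / 2) ^ p := by gcongr
    _ = 2 ^ p * (1 / |x m| ^ p) := by rw [div_pow]; field_simp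

/-- A summable majorant, uniform in the dilation parameter, for the transform of a test function
sampled at the dilated points `T (ω m - ω k)`. -/
lemma exists_summable_bound_expTransform {p : ℕ} {ω : ℕ → ℝ} (hω0 : ω 0 = 0)
    (hinj : Function.Injective ω) (hsum : Summable fun m : ℕ => 1 / |ω (m + 1)| ^ p)
    {u : ℝ → ℂ} (hu : ContDiff ℝ (⊤ : ℕ∞) u) (hc : HasCompactSupport u) (k : ℕ) :
    ∃ b : ℕ → ℝ, Summable b ∧
      ∀ T : ℝ, 1 ≤ T → ∀ m, ‖expTransform u (T * (ω m - ω k))‖ ≤ b m := by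
  obtain ⟨C, hC, hdecay⟩ := exists_norm_expTransform_le hu hc p
  have hne : ∀ᶠ m in .atTop, ω m ≠ 0 := by
    filter_upwards [Filter.eventually_gt_atTop 0] with m hm h
    exact hm.ne' (hinj (h.trans hω0.symm))
  have hshift := summable_one_div_abs_sub_pow hne
    ((summable_nat_add_iff (f := fun m => 1 / |ω m| ^ p) 1).mp hsum) (ω k)
  refine ⟨fun m => C * (1 / |ω m - ω k| ^ p) + if m = k then ‖expTransform u 0‖ else 0,
    (hshift.mul_left C).add (hasSum_ite_eq k _).summable, fun T hT m => ?_⟩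
  by_cases hmk : m = k
  · subst hmk
    simp only [sub_self, mul_zero, if_true]
    linarith [show 0 ≤ C * (1 / |(0 : ℝ)| ^ p) by positivity]
  · have hpos : 0 < |ω m - ω k| := abs_pos.mpr (sub_ne_zero.mpr (hinj.ne hmk))
    simp only [hmk, if_false, add_zero]
    rw [mul_one_div, le_div_iff₀ (by positivity), mul_comm]
    refine le_trans ?_ (hdecay (T * (ω m - ω k)))
    rw [abs_mul, abs_of_pos (by linarith : 0 < T)]
    gcongr
    exact le_mul_of_one_le_left hpos.le hT

/-- Orthogonality against real test functions extends to complex ones. -/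
lemma tsum_expTransform_mul_eq_zero {p : ℕ} {ω : ℕ → ℝ} (hω0 : ω 0 = 0)
    (hinj : Function.Injective ω) (hsum : Summable fun m : ℕ => 1 / |ω (m + 1)| ^ p)
    {g : ℕ → ℂ} {M : ℝ} (hg : ∀ m, ‖g m‖ ≤ M)
    (horth : ∀ u : ℝ → ℝ, ContDiff ℝ (⊤ : ℕ∞) u → HasCompactSupport u →
      Function.support u ⊆ Set.Ioi 0 →
      ∑' m : ℕ, (∫ s in Set.Ioi (0:ℝ), Complex.exp (Complex.I * ω m * s) * (u s : ℂ)) * g m = 0)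
    {u : ℝ → ℂ} (hu : ContDiff ℝ (⊤ : ℕ∞) u) (hc : HasCompactSupport u)
    (hs : Function.support u ⊆ Set.Ioi 0) :
    ∑' m, expTransform u (ω m) * g m = 0 := by
  have real_case : ∀ v : ℝ → ℝ, ContDiff ℝ (⊤ : ℕ∞) v → HasCompactSupport v →
      Function.support v ⊆ Set.Ioi 0 →
      HasSum (fun m => expTransform (fun s => (v s : ℂ)) (ω m) * g m) 0 := by
    intro v hv hvc hvs
    have hv' : ContDiff ℝ (⊤ : ℕ∞) fun s => (v s : ℂ) := Complex.ofRealCLM.contDiff.comp hv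
    have hvc' : HasCompactSupport fun s => (v s : ℂ) :=
      hvc.comp_left (g := Complex.ofReal) Complex.ofReal_zero
    obtain ⟨b, hb, hle⟩ := exists_summable_bound_expTransform hω0 hinj hsum hv' hvc' 0
    have hsm : Summable fun m => expTransform (fun s => (v s : ℂ)) (ω m) * g m := by
      refine Summable.of_norm_bounded (hb.mul_right M) fun m => ?_
      have hm := hle 1 le_rfl m
      rw [hω0, sub_zero, one_mul] at hm
      rw [norm_mul]
      exact mul_le_mul hm (hg m) (norm_nonneg _) ((norm_nonneg _).trans hm)
    rw [← horth v hv hvc hvs]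
    convert hsm.hasSum using 5 with m
    refine setIntegral_eq_integral_of_forall_compl_eq_zero fun s hs => ?_
    have : v s = 0 := by
      by_contra h
      exact hs (hvs h)
    simp [this]
  have hre := real_case (fun s => (u s).re) (Complex.reCLM.contDiff.comp hu)
    (hc.comp_left (g := Complex.re) Complex.zero_re)
    fun s h => hs fun h0 => h (by simp [h0])
  have him := real_case (fun s => (u s).im) (Complex.imCLM.contDiff.comp hu)
    (hc.comp_left (g := Complex.im) Complex.zero_im)
    fun s h => hs fun h0 => h (by simp [h0])
  have hadd := hre.add (him.mul_left Complex.I)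
  rw [mul_zero, add_zero] at hadd
  rw [← hadd.tsum_eq]
  congr 1 with m
  have hsplit : expTransform u (ω m) = expTransform (fun s => ((u s).re : ℂ)) (ω m) +
      Complex.I * expTransform (fun s => ((u s).im : ℂ)) (ω m) := by
    unfold expTransform
    rw [← integral_const_mul, ← integral_add]
    · congr 1 with s
      conv_lhs => rw [← Complex.re_add_im (u s)]
      ring
    · exact integrable_exp_mul (Complex.continuous_ofReal.comp (Complex.continuous_re.comp
        hu.continuous)) (hc.comp_left (g := Complex.ofReal ∘ Complex.re) (by simp)) _
    · exact (integrable_exp_mul (Complex.continuous_ofReal.comp (Complex.continuous_im.comp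
        hu.continuous)) (hc.comp_left (g := Complex.ofReal ∘ Complex.im) (by simp)) _).const_mul _
  rw [hsplit]
  ring

/-- Density of the moment map: if `h ∈ ℓ²` is orthogonal to all moment vectors
`(û(ω_m))_m` with `û(ω) = ∫₀^∞ e^{iωs} u(s) ds`, for every smooth compactly supported
real control `u` supported in `(0, ∞)`, then `h = 0`. Here `ω 0 = 0`, the `ω m` are
pairwise distinct, and `∑_{m≥1} |ω m|⁻ᵖ < ∞` for some `p ≥ 1`. -/
theorem moment_orthogonality_implies_zero (p : ℕ) (hp : 1 ≤ p)
    (ω : ℕ → ℝ) (hω0 : ω 0 = 0) (hinj : Function.Injective ω)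
    (hsum : Summable fun m : ℕ => 1 / |ω (m + 1)| ^ p)
    (h : ℕ → ℂ) (hl2 : Summable fun m => ‖h m‖ ^ 2)
    (horth : ∀ u : ℝ → ℝ, ContDiff ℝ (⊤ : ℕ∞) u → HasCompactSupport u →
      Function.support u ⊆ Set.Ioi 0 →
      ∑' m : ℕ, (∫ s in Set.Ioi (0:ℝ), Complex.exp (Complex.I * ω m * s) * (u s : ℂ)) *
        (starRingEnd ℂ) (h m) = 0) :
    h = 0 := by
  obtain ⟨M, hM⟩ : ∃ M : ℝ, ∀ m, ‖(starRingEnd ℂ) (h m)‖ ≤ M := by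
    refine ⟨√(∑' m, ‖h m‖ ^ 2), fun m => ?_⟩
    rw [RCLike.norm_conj]
    exact Real.le_sqrt_of_sq_le (hl2.le_tsum m fun _ _ => by positivity)
  let f : ContDiffBump (2 : ℝ) := ⟨1 / 2, 1, by norm_num, by norm_num⟩
  let φ : ℝ → ℂ := fun s => (f.normed volume s : ℂ)
  have hφ : ContDiff ℝ (⊤ : ℕ∞) φ := Complex.ofRealCLM.contDiff.comp f.contDiff_normed
  have hφc : HasCompactSupport φ :=
    (f.hasCompactSupport_normed (μ := volume)).comp_left (g := Complex.ofReal) Complex.ofReal_zero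
  have hφs : ∀ s, φ s ≠ 0 → 0 < s := by
    intro s h0
    have : s ∈ Function.support (f.normed volume) := fun h1 => h0 (by simp [φ, h1])
    rw [f.support_normed_eq, Real.ball_eq_Ioo] at this
    have := this.1
    norm_num [f] at this
    linarith
  have hφ0 : expTransform φ 0 = 1 := by
    simp only [expTransform, φ, Complex.ofReal_zero, mul_zero, zero_mul, Complex.exp_zero, one_mul]
    rw [integral_complex_ofReal, f.integral_normed, Complex.ofReal_one]
  funext k
  have hzero : ∀ T : ℝ, 1 ≤ T →
      ∑' m, expTransform φ (T * (ω m - ω k)) * (starRingEnd ℂ) (h m) = 0 := by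
    intro T hT
    have hT0 : 0 < T := by linarith
    simp_rw [← expTransform_dilate_modulate φ (ω k) _ hT0]
    refine tsum_expTransform_mul_eq_zero hω0 hinj hsum hM horth ?_ ?_ ?_
    · have h1 : ContDiff ℝ (⊤ : ℕ∞) fun s : ℝ => (s : ℂ) := Complex.ofRealCLM.contDiff
      have h2 : ContDiff ℝ (⊤ : ℕ∞) fun s : ℝ => φ (s / T) := hφ.comp (contDiff_id.div_const T)
      exact (Complex.contDiff_exp.comp (contDiff_const.mul h1).neg).mul (contDiff_const.mul h2)
    · have h2 : HasCompactSupport fun s : ℝ => φ (s / T) := by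
        simpa [div_eq_inv_mul] using hφc.comp_smul (inv_ne_zero hT0.ne')
      exact (h2.mul_left (f := fun _ => ((T⁻¹ : ℝ) : ℂ))).mul_left
    · intro s hs
      have : φ (s / T) ≠ 0 := right_ne_zero_of_mul (right_ne_zero_of_mul hs)
      exact (div_pos_iff_of_pos_right hT0).mp (hφs _ this)
  obtain ⟨b, hb, hle⟩ := exists_summable_bound_expTransform hω0 hinj hsum hφ hφc k
  obtain ⟨C, hC, hdecay⟩ := exists_norm_expTransform_le hφ hφc 1
  have hlim : Filter.Tendsto
      (fun T : ℝ => ∑' m, expTransform φ (T * (ω m - ω k)) * (starRingEnd ℂ) (h m)) .atTop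
      (nhds (∑' m, if m = k then (starRingEnd ℂ) (h k) else 0)) := by
    refine tendsto_tsum_of_dominated_convergence (hb.mul_right M) (fun m => ?_) ?_
    · by_cases hmk : m = k
      · subst hmk
        simp [hφ0]
      · have hpos : 0 < |ω m - ω k| := abs_pos.mpr (sub_ne_zero.mpr (hinj.ne hmk))
        simp only [hmk, if_false]
        have : Filter.Tendsto (fun T : ℝ => expTransform φ (T * (ω m - ω k))) .atTop (nhds 0) := by
          refine squeeze_zero_norm' (a := fun T : ℝ => C / |ω m - ω k| / T) ?_
            (tendsto_const_nhds.div_atTop Filter.tendsto_id)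
          filter_upwards [Filter.eventually_gt_atTop 0] with T hT
          have := hdecay (T * (ω m - ω k))
          rw [pow_one, abs_mul, abs_of_pos hT] at this
          rw [div_div, le_div_iff₀ (by positivity)]
          linarith
        simpa using this.mul_const ((starRingEnd ℂ) (h m))
    · filter_upwards [Filter.eventually_ge_atTop 1] with T hT m
      rw [norm_mul]
      exact mul_le_mul (hle T hT m) (hM m) (norm_nonneg _) ((norm_nonneg _).trans (hle T hT m))
  have hconst : Filter.Tendsto
      (fun T : ℝ => ∑' m, expTransform φ (T * (ω m - ω k)) * (starRingEnd ℂ) (h m)) .atTop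
      (nhds 0) :=
    tendsto_const_nhds.congr' (by
      filter_upwards [Filter.eventually_ge_atTop 1] with T hT using (hzero T hT).symm)
  have := tendsto_nhds_unique hlim hconst
  rw [tsum_ite_eq] at this
  simpa using this
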